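/- Let w ∈ A_{1,ℛ} on ℝ^{n₁} × ℝ^{n₂} and let I₂ ⊂ ℝ^{n₂} be a cube with sides parallel to the coordinate axes. Then there is a constant depending only on n₂ such that for every x ∈ ℝ^{n₁} and every ȳ ∈ I₂, ∫_{I₂} w(x,y) / |y − ȳ|^{n₂−1} dy ≲ ℓ(I₂) · [w]_{A_{1,ℛ}} · w(x,ȳ), for almost every (x,ȳ). The symmetric estimate in the first variable also holds: for every cube I₁ ⊂ ℝ^{n₁} and every x̄ ∈ I₁, ȳ ∈ ℝ^{n₂}, ∫_{I₁} w(x,ȳ) / |x − x̄|^{n₁−1} dx ≲ ℓ(I₁) · [w]_{A_{1,ℛ}} · w(x̄,ȳ). -/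

import Mathlib

noncomputable section
open MeasureTheory ENNReal Set

abbrev E (m : ℕ) : Type := EuclideanSpace ℝ (Fin m)

/-- Axis-parallel cube in `ℝ^m` with corner `a` and side length `r`. -/
def cube {m : ℕ} (a : E m) (r : ℝ) : Set (E m) :=
  {x | ∀ i, x i ∈ Set.Icc (a i) (a i + r)}

/-- Rectangle `I₁ × I₂`, a product of two axis-parallel cubes. -/
def rect {n₁ n₂ : ℕ} (a₁ : E n₁) (r₁ : ℝ) (a₂ : E n₂) (r₂ : ℝ) : Set (E n₁ × E n₂) :=
  (cube a₁ r₁) ×ˢ (cube a₂ r₂)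

/-- `K` is an admissible `A_{p,ℛ}` constant for `w` (`p > 1`). -/
def rectApBound (n₁ n₂ : ℕ) (p K : ℝ) (w : E n₁ × E n₂ → ℝ) : Prop :=
  ∀ (a₁ : E n₁) (r₁ : ℝ) (a₂ : E n₂) (r₂ : ℝ), 0 < r₁ → 0 < r₂ →
    ((∫⁻ z in rect a₁ r₁ a₂ r₂, ENNReal.ofReal (w z)) / volume (rect a₁ r₁ a₂ r₂)) *
      (((∫⁻ z in rect a₁ r₁ a₂ r₂, ENNReal.ofReal (w z ^ (-1 / (p - 1)))) /
        volume (rect a₁ r₁ a₂ r₂)) ^ (p - 1)) ≤ ENNReal.ofReal K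

/-- `K` is an admissible `A_{1,ℛ}` constant for `w`. -/
def rectA1Bound (n₁ n₂ : ℕ) (K : ℝ) (w : E n₁ × E n₂ → ℝ) : Prop :=
  ∀ (a₁ : E n₁) (r₁ : ℝ) (a₂ : E n₂) (r₂ : ℝ), 0 < r₁ → 0 < r₂ →
    (∫⁻ z in rect a₁ r₁ a₂ r₂, ENNReal.ofReal (w z)) / volume (rect a₁ r₁ a₂ r₂)
      ≤ ENNReal.ofReal K *
        essInf (fun z => ENNReal.ofReal (w z)) (volume.restrict (rect a₁ r₁ a₂ r₂))

/-- The non-standard average `π_{I₁×I₂}(f)(x,y) = f_{I₁}^y + f_{I₂}^x - f_{I₁×I₂}`. -/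
def piR {n₁ n₂ : ℕ} (a₁ : E n₁) (r₁ : ℝ) (a₂ : E n₂) (r₂ : ℝ)
    (f : E n₁ × E n₂ → ℝ) (z : E n₁ × E n₂) : ℝ :=
  (⨍ x in cube a₁ r₁, f (x, z.2)) + (⨍ y in cube a₂ r₂, f (z.1, y)) -
    ⨍ u in rect a₁ r₁ a₂ r₂, f u

/-- Mixed second partial `∂²f/∂xᵢ∂yⱼ`. -/
def mixedPartial {n₁ n₂ : ℕ} (f : E n₁ × E n₂ → ℝ) (i : Fin n₁) (j : Fin n₂)
    (z : E n₁ × E n₂) : ℝ :=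
  fderiv ℝ (fun x => fderiv ℝ (fun y => f (x, y)) z.2 (EuclideanSpace.single j (1:ℝ))) z.1
    (EuclideanSpace.single i (1:ℝ))

/-- Hilbert–Schmidt norm `|∇ₓ∇_y f|` of the mixed-derivative matrix. -/
def mixedGradNorm {n₁ n₂ : ℕ} (f : E n₁ × E n₂ → ℝ) (z : E n₁ × E n₂) : ℝ :=
  Real.sqrt (∑ i : Fin n₁, ∑ j : Fin n₂, (mixedPartial f i j z) ^ 2)

/-- Weighted `L^p` "norm" on a set, as an extended nonnegative real. -/
def lpW {α : Type*} [MeasureSpace α] (p : ℝ) (A : Set α) (w : α → ℝ) (g : α → ℝ) : ℝ≥0∞ :=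
  (∫⁻ z in A, ENNReal.ofReal |g z| ^ p * ENNReal.ofReal (w z)) ^ (1 / p)

section

open Filter Topology Metric

theorem cube_eq_preimage {m : ℕ} (a : E m) (r : ℝ) :
    cube a r = WithLp.ofLp ⁻¹' Icc (a : Fin m → ℝ) (fun i => a i + r) := by
  ext x
  simp [cube, Pi.le_def, forall_and]

theorem isClosed_cube {m : ℕ} (a : E m) (r : ℝ) : IsClosed (cube a r) := by
  rw [cube_eq_preimage]
  exact isClosed_Icc.preimage (PiLp.continuous_ofLp 2 _)

theorem isCompact_cube {m : ℕ} (a : E m) (r : ℝ) : IsCompact (cube a r) := by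
  rw [cube_eq_preimage]
  exact (PiLp.homeomorph 2 fun _ : Fin m => ℝ).isClosedEmbedding.isCompact_preimage isCompact_Icc

theorem volume_cube {m : ℕ} (a : E m) (r : ℝ) : volume (cube a r) = ENNReal.ofReal r ^ m := by
  rw [cube_eq_preimage, (PiLp.volume_preserving_ofLp (Fin m)).measure_preimage
    measurableSet_Icc.nullMeasurableSet, Real.volume_Icc_pi]
  simp

theorem nonempty_interior_cube {m : ℕ} (a : E m) {r : ℝ} (hr : 0 < r) :
    (interior (cube a r)).Nonempty := by
  have hsub : WithLp.ofLp ⁻¹' (univ.pi fun i => Ioo (a i) (a i + r)) ⊆ interior (cube a r) := by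
    refine interior_maximal (fun x hx i => Ioo_subset_Icc_self (hx i trivial)) ?_
    exact (isOpen_set_pi finite_univ fun _ _ => isOpen_Ioo).preimage (PiLp.continuous_ofLp 2 _)
  refine ⟨WithLp.toLp 2 fun i => a i + r / 2, hsub fun i _ => ?_⟩
  constructor <;> simp only <;> linarith

theorem norm_le_card_mul {m : ℕ} (x : E m) {r : ℝ} (hx : ∀ i, |x i| ≤ r) : ‖x‖ ≤ m * r := by
  calc ‖x‖ = ‖∑ i, EuclideanSpace.single i (x i)‖ := by
        congr 1
        ext j
        simp [Finset.sum_apply, Pi.single_apply]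
    _ ≤ ∑ i, ‖EuclideanSpace.single i (x i)‖ := norm_sum_le _ _
    _ ≤ ∑ _i : Fin m, r := by
        gcongr with i
        simpa using hx i
    _ = m * r := by simp

theorem cube_subset_closedBall {m : ℕ} {a x : E m} {r : ℝ} (hx : x ∈ cube a r) :
    cube a r ⊆ closedBall x (m * r) := by
  intro y hy
  rw [mem_closedBall, dist_eq_norm]
  refine norm_le_card_mul _ fun i => ?_
  have h1 := hx i
  have h2 := hy i
  simp only [mem_Icc] at h1 h2
  simp only [PiLp.sub_apply, abs_le]
  constructor <;> linarith

/-- The point of the lattice `s ℤ^m` with integer coordinates `v`. -/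
def latticePoint {m : ℕ} (s : ℝ) (v : Fin m → ℤ) : E m := WithLp.toLp 2 fun i => s * v i

theorem mem_cube_latticePoint_floor {m : ℕ} {s : ℝ} (hs : 0 < s) (x : E m) :
    x ∈ cube (latticePoint s fun i => ⌊x i / s⌋) s := by
  intro i
  have h1 := Int.floor_le (x i / s)
  have h2 := (Int.lt_floor_add_one (x i / s)).le
  rw [le_div_iff₀ hs] at h1
  rw [div_le_iff₀ hs] at h2
  simp only [latticePoint, mem_Icc]
  constructor <;> linarith

theorem closedBall_subset_cube_latticePoint {m : ℕ} {s : ℝ} (hs : 0 < s) (x : E m) :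
    closedBall x s ⊆ cube (latticePoint s fun i => ⌊x i / s⌋ - 1) (3 * s) := by
  intro y hy i
  rw [mem_closedBall, dist_eq_norm] at hy
  have h := (PiLp.norm_apply_le (y - x) i).trans hy
  have h3 := mem_cube_latticePoint_floor hs x i
  simp only [PiLp.sub_apply, Real.norm_eq_abs, abs_le] at h
  simp only [latticePoint, mem_Icc] at h3 ⊢
  push_cast
  constructor <;> linarith

/-- Lebesgue differentiation along lattice cubes. -/
theorem ae_tendsto_lintegral_latticeCube_div {m : ℕ} {g : E m → ℝ≥0∞}
    (hg : AEMeasurable g volume) (hfin : ∫⁻ x, g x ≠ ∞) {s : ℕ → ℝ} (hs : ∀ k, 0 < s k)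
    (hs0 : Tendsto s atTop (𝓝 0)) :
    ∀ᵐ x : E m, Tendsto
      (fun k => (∫⁻ y in cube (latticePoint (s k) fun i => ⌊x i / s k⌋) (s k), g y) /
        volume (cube (latticePoint (s k) fun i => ⌊x i / s k⌋) (s k)))
      atTop (𝓝 (g x)) := by
  have hball : volume (ball (0 : E m) 1) ≠ ∞ := measure_ball_lt_top.ne
  set B : NNReal := (volume (ball (0 : E m) 1)).toNNReal
  have hB : volume (ball (0 : E m) 1) = B := (ENNReal.coe_toNNReal hball).symm
  set C : NNReal := 3 ^ m + (3 * m) ^ m * B with hC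
  have hdoubling : ∀ x : E m, ∃ᶠ r in 𝓝[>] (0 : ℝ),
      volume (closedBall x (3 * r)) ≤ C * volume (closedBall x r) := by
    intro x
    refine Eventually.frequently ?_
    filter_upwards [self_mem_nhdsWithin] with r (hr : 0 < r)
    rw [Measure.addHaar_closedBall _ _ (by positivity), Measure.addHaar_closedBall _ _ hr.le,
      finrank_euclideanSpace_fin, mul_pow, ENNReal.ofReal_mul (by positivity), mul_assoc]
    gcongr
    rw [ENNReal.ofReal_pow (by positivity), hC]
    push_cast
    simp
  filter_upwards [(Vitali.vitaliFamily volume C hdoubling).ae_tendsto_lintegral_div hg hfin]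
    with x hx
  refine hx.comp ((VitaliFamily.tendsto_filterAt_iff _).2 ⟨Eventually.of_forall fun k => ?_, ?_⟩)
  · refine ⟨isClosed_cube _ _, nonempty_interior_cube _ (hs k), m * s k,
      cube_subset_closedBall (mem_cube_latticePoint_floor (hs k) x), ?_⟩
    have := hs k
    rw [Measure.addHaar_closedBall _ _ (by positivity), volume_cube, hB,
      finrank_euclideanSpace_fin, ← mul_assoc, mul_pow, ENNReal.ofReal_mul (by positivity),
      ENNReal.ofReal_pow this.le, mul_right_comm]
    gcongr
    rw [ENNReal.ofReal_pow (by positivity), ENNReal.ofReal_mul (by positivity), hC]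
    push_cast
    simp
  · intro ε hε
    have h0 : Tendsto (fun k => m * s k) atTop (𝓝 0) := by simpa using hs0.const_mul (m : ℝ)
    filter_upwards [h0.eventually (gt_mem_nhds hε)] with k hk
    exact (cube_subset_closedBall (mem_cube_latticePoint_floor (hs k) x)).trans
      (closedBall_subset_closedBall hk.le)

/-- The `A₁` bound on rectangles passes to almost every slice, for each fixed cube. -/
theorem ae_setLIntegral_slice_le {n₁ n₂ : ℕ} {f : E n₁ × E n₂ → ℝ≥0∞} {K : ℝ≥0∞}
    (hf : AEMeasurable f volume) (hfin : ∀ S, IsCompact S → ∫⁻ z in S, f z ≠ ∞)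
    (hK : ∀ (a₁ : E n₁) (r₁ : ℝ) (a₂ : E n₂) (r₂ : ℝ), 0 < r₁ → 0 < r₂ →
      ∀ᵐ z, z ∈ rect a₁ r₁ a₂ r₂ →
        ∫⁻ u in rect a₁ r₁ a₂ r₂, f u ≤ K * volume (rect a₁ r₁ a₂ r₂) * f z)
    (a : E n₂) {r : ℝ} (hr : 0 < r) :
    ∀ᵐ z : E n₁ × E n₂, z.2 ∈ cube a r →
      ∫⁻ y in cube a r, f (z.1, y) ≤ K * volume (cube a r) * f z := by
  set s : ℕ → ℝ := fun k => (1 / 2) ^ k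
  have hs : ∀ k, 0 < s k := fun k => by positivity
  have hs0 : Tendsto s atTop (𝓝 0) := tendsto_pow_atTop_nhds_zero_of_lt_one (by norm_num) (by norm_num)
  set F : E n₁ → ℝ≥0∞ := fun x => ∫⁻ y in cube a r, f (x, y)
  have hF : AEMeasurable F volume := by
    refine AEMeasurable.lintegral_prod_right' (hf.mono_ac ?_)
    exact Measure.AbsolutelyContinuous.prod .rfl Measure.restrict_le_self.absolutelyContinuous
  have hset : ∀ S : Set (E n₁), ∫⁻ x in S, F x = ∫⁻ z in S ×ˢ cube a r, f z := fun S =>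
    (setLIntegral_prod f hf.restrict).symm
  have hlim : ∀ᵐ z : E n₁ × E n₂, ∀ N : ℕ, Tendsto
      (fun k => (∫⁻ y in cube (latticePoint (s k) fun i => ⌊z.1 i / s k⌋) (s k),
        (closedBall 0 N).indicator F y) /
        volume (cube (latticePoint (s k) fun i => ⌊z.1 i / s k⌋) (s k)))
      atTop (𝓝 ((closedBall 0 N).indicator F z.1)) := by
    refine ae_all_iff.2 fun N => Measure.quasiMeasurePreserving_fst.ae
      (ae_tendsto_lintegral_latticeCube_div (hF.indicator measurableSet_closedBall) ?_ hs hs0)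
    rw [lintegral_indicator measurableSet_closedBall, hset]
    exact hfin _ ((isCompact_closedBall _ _).prod (isCompact_cube _ _))
  have hrect : ∀ᵐ z : E n₁ × E n₂, ∀ (k : ℕ) (v : Fin n₁ → ℤ),
      z ∈ rect (latticePoint (s k) v) (s k) a r →
        ∫⁻ u in rect (latticePoint (s k) v) (s k) a r, f u ≤
          K * volume (rect (latticePoint (s k) v) (s k) a r) * f z :=
    ae_all_iff.2 fun k => ae_all_iff.2 fun v => hK _ _ _ _ (hs k) hr
  filter_upwards [hlim, hrect] with z hz hz' hzmem
  obtain ⟨N, hN⟩ := exists_nat_ge ‖z.1‖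
  have hFz : (closedBall 0 N).indicator F z.1 = F z.1 :=
    indicator_of_mem (by simpa using hN) _
  have hle := le_of_tendsto (hz N) (b := K * volume (cube a r) * f z)
    (Eventually.of_forall fun k => ?_)
  · rwa [hFz] at hle
  · set v : Fin n₁ → ℤ := fun i => ⌊z.1 i / s k⌋
    have hvol : volume (cube (latticePoint (s k) v) (s k)) ≠ 0 := by
      simp [volume_cube, hs k]
    have hvol' : volume (cube (latticePoint (s k) v) (s k)) ≠ ∞ := by
      simp [volume_cube]
    rw [ENNReal.div_le_iff hvol hvol']
    calc _ ≤ ∫⁻ x in cube (latticePoint (s k) v) (s k), F x :=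
          lintegral_mono (indicator_le_self _ _)
      _ = ∫⁻ u in rect (latticePoint (s k) v) (s k) a r, f u := hset _
      _ ≤ _ := hz' k v ⟨mem_cube_latticePoint_floor (hs k) z.1, hzmem⟩
      _ = _ := by
          rw [rect, Measure.volume_eq_prod, Measure.prod_prod]
          ring

/-- A function whose averages over dyadic balls around `x` are controlled by `A` has its integral
against the kernel `‖y - x‖ ^ (1 - m)` controlled by `A`. -/
theorem setLIntegral_div_norm_rpow_le {m : ℕ} (hm : 0 < m) {g : E m → ℝ≥0∞} {A : ℝ≥0∞} {x a : E m}
    {r : ℝ} (hr : 0 < r) (hx : x ∈ cube a r)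
    (hg : ∀ k : ℕ, ∫⁻ y in closedBall x (m * r * (1 / 2) ^ k), g y ≤
      ENNReal.ofReal ((3 * (m * r * (1 / 2) ^ k)) ^ m) * A) :
    ∫⁻ y in cube a r, g y / ENNReal.ofReal (‖y - x‖ ^ ((m : ℝ) - 1)) ≤
      ENNReal.ofReal (6 ^ m * m * r) * A := by
  have : Nonempty (Fin m) := ⟨⟨0, hm⟩⟩
  have hm' : (0 : ℝ) < m := by exact_mod_cast hm
  set s : ℕ → ℝ := fun k => m * r * (1 / 2) ^ k with hsdef
  have hs : ∀ k, 0 < s k := fun k => by positivity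
  set D : ℕ → Set (E m) := fun k => closedBall x (s k) \ closedBall x (s (k + 1))
  have hcover : cube a r \ {x} ⊆ ⋃ k, D k := by
    rintro y ⟨hy, hne⟩
    have hy' : dist y x ≤ m * r := cube_subset_closedBall hx hy
    have hpos : 0 < dist y x := dist_pos.2 hne
    have hmr : 0 < m * r := by positivity
    obtain ⟨k, hk1, hk2⟩ := exists_nat_pow_near_of_lt_one (x := dist y x / (m * r))
      (y := (1 / 2 : ℝ)) (by positivity) ((div_le_one hmr).2 hy') (by norm_num) (by norm_num)
    rw [lt_div_iff₀ hmr] at hk1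
    rw [div_le_iff₀ hmr] at hk2
    refine mem_iUnion.2 ⟨k, ?_, ?_⟩
    · simpa [hsdef, mul_comm] using hk2
    · simpa [hsdef, mul_comm] using hk1
  have hD : ∀ k, ∫⁻ y in D k, g y / ENNReal.ofReal (‖y - x‖ ^ ((m : ℝ) - 1)) ≤
      ENNReal.ofReal (6 ^ m * m * r / 2) * A * 2⁻¹ ^ k := by
    intro k
    have hp : 0 < s (k + 1) ^ ((m : ℝ) - 1) := Real.rpow_pos_of_pos (hs _) _
    calc ∫⁻ y in D k, g y / ENNReal.ofReal (‖y - x‖ ^ ((m : ℝ) - 1))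
        ≤ ∫⁻ y in D k, (ENNReal.ofReal (s (k + 1) ^ ((m : ℝ) - 1)))⁻¹ * g y := by
          refine setLIntegral_mono' (measurableSet_closedBall.diff measurableSet_closedBall) ?_
          rintro y ⟨-, hy⟩
          rw [mem_closedBall, dist_eq_norm, not_le] at hy
          rw [ENNReal.div_eq_inv_mul]
          gcongr
          exact sub_nonneg.2 (by exact_mod_cast hm)
      _ = (ENNReal.ofReal (s (k + 1) ^ ((m : ℝ) - 1)))⁻¹ * ∫⁻ y in D k, g y :=
          lintegral_const_mul' _ _ (by simpa using hp)
      _ ≤ (ENNReal.ofReal (s (k + 1) ^ ((m : ℝ) - 1)))⁻¹ *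
            (ENNReal.ofReal ((3 * s k) ^ m) * A) := by
          gcongr
          exact (lintegral_mono_set sdiff_subset).trans (hg k)
      _ = ENNReal.ofReal (6 ^ m * m * r / 2) * A * 2⁻¹ ^ k := by
          rw [← ENNReal.ofReal_inv_of_pos hp, ← mul_assoc, ← ENNReal.ofReal_mul (by positivity),
            mul_right_comm]
          congr 1
          have h2 : (2⁻¹ : ℝ≥0∞) ^ k = ENNReal.ofReal ((1 / 2) ^ k) := by
            rw [ENNReal.ofReal_pow (by norm_num), one_div, ENNReal.ofReal_inv_of_pos (by norm_num)]
            simp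
          rw [h2, ← ENNReal.ofReal_mul (by positivity)]
          congr 1
          have hsk : s (k + 1) = s k / 2 := by
            simp only [hsdef, pow_succ]; ring
          have h3 : s (k + 1) ^ ((m : ℝ) - 1) = (s k) ^ m / 2 ^ m / (s k / 2) := by
            rw [Real.rpow_sub_one (hs _).ne', Real.rpow_natCast, hsk, div_pow]
          have h6 : (6 : ℝ) ^ m = 3 ^ m * 2 ^ m := by rw [← mul_pow]; norm_num
          have hne : s k ≠ 0 := (hs k).ne'
          have hs' : m * r * (1 / 2) ^ k = s k := rfl
          rw [h3, h6, mul_pow 3]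
          calc _ = 3 ^ m * 2 ^ m * s k / 2 := by field_simp
            _ = _ := by rw [← hs']; ring
  calc _ = ∫⁻ y in cube a r \ {x}, g y / ENNReal.ofReal (‖y - x‖ ^ ((m : ℝ) - 1)) :=
        setLIntegral_congr (sdiff_null_ae_eq_self (measure_singleton x)).symm
    _ ≤ ∫⁻ y in ⋃ k, D k, g y / ENNReal.ofReal (‖y - x‖ ^ ((m : ℝ) - 1)) :=
        lintegral_mono_set hcover
    _ ≤ ∑' k, ∫⁻ y in D k, g y / ENNReal.ofReal (‖y - x‖ ^ ((m : ℝ) - 1)) :=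
        lintegral_iUnion_le _ _
    _ ≤ ∑' k, ENNReal.ofReal (6 ^ m * m * r / 2) * A * 2⁻¹ ^ k := ENNReal.tsum_le_tsum hD
    _ = ENNReal.ofReal (6 ^ m * m * r / 2) * 2 * A := by
        rw [ENNReal.tsum_mul_left, ENNReal.tsum_geometric_two]; ring
    _ = _ := by
        rw [← ENNReal.ofReal_ofNat 2, ← ENNReal.ofReal_mul (by positivity)]
        congr 2
        ring

theorem ae_kernel_estimate {n₁ n₂ : ℕ} (hn₂ : 0 < n₂) {f : E n₁ × E n₂ → ℝ≥0∞} {K : ℝ≥0∞}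
    (hf : AEMeasurable f volume) (hfin : ∀ S, IsCompact S → ∫⁻ z in S, f z ≠ ∞)
    (hK : ∀ (a₁ : E n₁) (r₁ : ℝ) (a₂ : E n₂) (r₂ : ℝ), 0 < r₁ → 0 < r₂ →
      ∀ᵐ z, z ∈ rect a₁ r₁ a₂ r₂ →
        ∫⁻ u in rect a₁ r₁ a₂ r₂, f u ≤ K * volume (rect a₁ r₁ a₂ r₂) * f z)
    (a : E n₂) {r : ℝ} (hr : 0 < r) :
    ∀ᵐ z : E n₁ × E n₂, z.2 ∈ cube a r →
      ∫⁻ y in cube a r, f (z.1, y) / ENNReal.ofReal (‖y - z.2‖ ^ ((n₂ : ℝ) - 1)) ≤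
        ENNReal.ofReal (6 ^ n₂ * n₂ * r) * (K * f z) := by
  have hn : (0 : ℝ) < n₂ := by exact_mod_cast hn₂
  set s : ℕ → ℝ := fun k => n₂ * r * (1 / 2) ^ k
  have hs : ∀ k, 0 < s k := fun k => by positivity
  have hslice : ∀ᵐ z : E n₁ × E n₂, ∀ (k : ℕ) (v : Fin n₂ → ℤ),
      z.2 ∈ cube (latticePoint (s k) v) (3 * s k) →
        ∫⁻ y in cube (latticePoint (s k) v) (3 * s k), f (z.1, y) ≤
          K * volume (cube (latticePoint (s k) v) (3 * s k)) * f z :=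
    ae_all_iff.2 fun k => ae_all_iff.2 fun v =>
      ae_setLIntegral_slice_le hf hfin hK _ (mul_pos three_pos (hs k))
  filter_upwards [hslice] with z hz hzmem
  refine setLIntegral_div_norm_rpow_le (g := fun y => f (z.1, y)) hn₂ hr hzmem fun k => ?_
  have hsub := closedBall_subset_cube_latticePoint (hs k) z.2
  refine (lintegral_mono_set hsub).trans
    ((hz k _ (hsub (mem_closedBall_self (hs k).le))).trans_eq ?_)
  rw [volume_cube, ENNReal.ofReal_pow (mul_pos three_pos (hs k)).le]
  ring

theorem rectA1Bound.ae_setLIntegral_le {n₁ n₂ : ℕ} {K : ℝ} {w : E n₁ × E n₂ → ℝ}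
    (h : rectA1Bound n₁ n₂ K w) (a₁ : E n₁) (r₁ : ℝ) (a₂ : E n₂) (r₂ : ℝ)
    (hr₁ : 0 < r₁) (hr₂ : 0 < r₂) :
    ∀ᵐ z, z ∈ rect a₁ r₁ a₂ r₂ → ∫⁻ u in rect a₁ r₁ a₂ r₂, ENNReal.ofReal (w u) ≤
      ENNReal.ofReal K * volume (rect a₁ r₁ a₂ r₂) * ENNReal.ofReal (w z) := by
  have hmeas : MeasurableSet (rect a₁ r₁ a₂ r₂) :=
    (isClosed_cube _ _).measurableSet.prod (isClosed_cube _ _).measurableSet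
  have hvol : volume (rect a₁ r₁ a₂ r₂) = ENNReal.ofReal r₁ ^ n₁ * ENNReal.ofReal r₂ ^ n₂ := by
    rw [rect, Measure.volume_eq_prod, Measure.prod_prod, volume_cube, volume_cube]
  have hvol0 : volume (rect a₁ r₁ a₂ r₂) ≠ 0 := by simp [hvol, hr₁, hr₂]
  have hvolt : volume (rect a₁ r₁ a₂ r₂) ≠ ∞ := by
    rw [hvol]; finiteness
  have hle := h a₁ r₁ a₂ r₂ hr₁ hr₂
  rw [ENNReal.div_le_iff hvol0 hvolt] at hle
  have hess : ∀ᵐ z ∂volume.restrict (rect a₁ r₁ a₂ r₂),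
      essInf (fun z => ENNReal.ofReal (w z)) (volume.restrict (rect a₁ r₁ a₂ r₂)) ≤
        ENNReal.ofReal (w z) := ae_essInf_le
  filter_upwards [(ae_restrict_iff' hmeas).1 hess] with z hz hzmem
  calc _ ≤ _ := hle
    _ ≤ ENNReal.ofReal K * ENNReal.ofReal (w z) * volume (rect a₁ r₁ a₂ r₂) := by
        gcongr
        exact hz hzmem
    _ = _ := by ring

end

/-- the two kernel estimates used in the proof of Proposition 1.7 of the
paper: if `w ∈ A_{1,ℛ}`, then for every axis-parallel cube `I₂ ⊂ ℝ^{n₂}` and a.e. `(x,ȳ)`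
with `ȳ ∈ I₂`, `∫_{I₂} w(x,y)/|y-ȳ|^{n₂-1} dy ≲ ℓ(I₂) [w]_{A_{1,ℛ}} w(x,ȳ)`, and the
symmetric estimate holds in the first variable. -/
theorem a1_kernel_estimates (n₁ n₂ : ℕ) (hn₁ : 0 < n₁) (hn₂ : 0 < n₂) :
    ∃ C : ℝ, 0 < C ∧
      ∀ (w : E n₁ × E n₂ → ℝ), (∀ z, 0 ≤ w z) → LocallyIntegrable w volume →
        ∀ K : ℝ, 1 ≤ K → rectA1Bound n₁ n₂ K w →
          (∀ (a₂ : E n₂) (r₂ : ℝ), 0 < r₂ →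
            ∀ᵐ z : E n₁ × E n₂, z.2 ∈ cube a₂ r₂ →
              (∫⁻ y in cube a₂ r₂,
                  ENNReal.ofReal (w (z.1, y)) /
                    ENNReal.ofReal (‖y - z.2‖ ^ ((n₂ : ℝ) - 1)))
                ≤ ENNReal.ofReal (C * r₂ * K) * ENNReal.ofReal (w z)) ∧
          (∀ (a₁ : E n₁) (r₁ : ℝ), 0 < r₁ →
            ∀ᵐ z : E n₁ × E n₂, z.1 ∈ cube a₁ r₁ →
              (∫⁻ x in cube a₁ r₁,
                  ENNReal.ofReal (w (x, z.2)) /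
                    ENNReal.ofReal (‖x - z.1‖ ^ ((n₁ : ℝ) - 1)))
                ≤ ENNReal.ofReal (C * r₁ * K) * ENNReal.ofReal (w z)) := by
  refine ⟨6 ^ n₁ * n₁ + 6 ^ n₂ * n₂, by positivity, fun w _ hw K hK hA1 => ?_⟩
  have hf : AEMeasurable (fun z => ENNReal.ofReal (w z)) volume :=
    hw.aestronglyMeasurable.aemeasurable.ennreal_ofReal
  have hfin : ∀ S, IsCompact S → ∫⁻ z in S, ENNReal.ofReal (w z) ≠ ∞ := fun S hS =>
    (hw.integrableOn_isCompact hS).lintegral_lt_top.ne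
  have hrect := hA1.ae_setLIntegral_le
  have hconst : ∀ {c r : ℝ} {A : ℝ≥0∞}, 0 < r → c ≤ 6 ^ n₁ * n₁ + 6 ^ n₂ * n₂ →
      ENNReal.ofReal (c * r) * (ENNReal.ofReal K * A) ≤
        ENNReal.ofReal ((6 ^ n₁ * n₁ + 6 ^ n₂ * n₂) * r * K) * A := by
    intro c r A hr hc
    rw [ENNReal.ofReal_mul' (zero_le_one.trans hK), mul_assoc]
    gcongr
  refine ⟨fun a₂ r₂ hr₂ => ?_, fun a₁ r₁ hr₁ => ?_⟩
  · filter_upwards [ae_kernel_estimate hn₂ hf hfin hrect a₂ hr₂] with z hz hzmem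
    exact (hz hzmem).trans (hconst hr₂ (le_add_of_nonneg_left (by positivity)))
  · have hswap : MeasurePreserving (Prod.swap : E n₂ × E n₁ → E n₁ × E n₂) volume volume :=
      Measure.measurePreserving_swap
    have hswap' : MeasurePreserving (Prod.swap : E n₁ × E n₂ → E n₂ × E n₁) volume volume :=
      Measure.measurePreserving_swap
    have hemb : MeasurableEmbedding (Prod.swap : E n₂ × E n₁ → E n₁ × E n₂) :=
      MeasurableEquiv.prodComm.measurableEmbedding
    have hset : ∀ S : Set (E n₂ × E n₁), ∫⁻ z in S, ENNReal.ofReal (w z.swap) =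
        ∫⁻ z in Prod.swap ⁻¹' S, ENNReal.ofReal (w z) := fun S =>
      hswap.setLIntegral_comp_preimage_emb hemb (fun z => ENNReal.ofReal (w z))
        (Prod.swap ⁻¹' S)
    have hpre : ∀ (b₂ : E n₂) (t₂ : ℝ) (b₁ : E n₁) (t₁ : ℝ),
        Prod.swap ⁻¹' rect b₂ t₂ b₁ t₁ = rect b₁ t₁ b₂ t₂ := fun _ _ _ _ => preimage_swap_prod _ _
    have hkey := ae_kernel_estimate (f := fun z : E n₂ × E n₁ => ENNReal.ofReal (w z.swap))
      (K := ENNReal.ofReal K) hn₁ (hf.comp_quasiMeasurePreserving hswap.quasiMeasurePreserving)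
      (fun S hS => by
        rw [hset, ← image_swap_eq_preimage_swap]
        exact hfin _ (hS.image continuous_swap))
      (fun b₂ t₂ b₁ t₁ ht₂ ht₁ => by
        filter_upwards [hswap.quasiMeasurePreserving.ae (hrect b₁ t₁ b₂ t₂ ht₁ ht₂)] with z hz hmem
        rw [hset, ← hswap'.measure_preimage_emb MeasurableEquiv.prodComm.measurableEmbedding, hpre]
        exact hz ⟨hmem.2, hmem.1⟩)
      a₁ hr₁
    filter_upwards [hswap'.quasiMeasurePreserving.ae hkey] with z hz hzmem
    exact (hz hzmem).trans (hconst hr₁ (le_add_of_nonneg_right (by positivity)))
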